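/- Let (P_n)_{n≥0} and (P̃_n)_{n≥0} be sequences in Mat_N(ℂ[x]) with P_n and P̃_n monic of degree n for every n. Let 𝔇 be the set of matrix differential operators B of size N for which there exist constant matrices Λ_n(B) with P_n·B = Λ_n(B)·P_n for all n, and let 𝔇̃ be defined analogously using (P̃_n). Suppose 𝒱 and 𝒩 are matrix differential operators and A_n, Ã_n are invertible constant matrices with P_n·𝒱 = A_n·P̃_n and P̃_n·𝒩 = Ã_n·P_n for all n. Then 𝔇 is commutative under composition (i.e. P·(B₁B₂) = P·(B₂B₁) for all P ∈ Mat_N(ℂ[x]) and all B₁, B₂ ∈ 𝔇) if and only if 𝔇̃ is commutative under composition. -/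

import Mathlib

open Polynomial

/-- Matrix polynomials of size `N` with complex coefficients. -/
abbrev MatPoly (N : ℕ) := Matrix (Fin N) (Fin N) (Polynomial ℂ)

/-- Entrywise derivative of a matrix polynomial. -/
noncomputable def matDeriv {N : ℕ} (P : MatPoly N) : MatPoly N :=
  Matrix.of fun i j => derivative (P i j)

/-- The right action of the differential operator `D = ∑_{j=0}^m ∂^j F_j` on a matrix
polynomial: `P·D = ∑_{j=0}^m P^{(j)} F_j`. -/
noncomputable def opApply {N : ℕ} (m : ℕ) (F : ℕ → MatPoly N) (P : MatPoly N) : MatPoly N :=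
  ∑ j ∈ Finset.range (m + 1), matDeriv^[j] P * F j

/-- A constant matrix viewed as a matrix polynomial. -/
noncomputable def cm {N : ℕ} (M : Matrix (Fin N) (Fin N) ℂ) : MatPoly N := M.map Polynomial.C

/-- The coefficient of `x^k` of a matrix polynomial. -/
def mcoeff {N : ℕ} (P : MatPoly N) (k : ℕ) : Matrix (Fin N) (Fin N) ℂ :=
  Matrix.of fun i j => (P i j).coeff k

/-- `P` is monic of degree `n`: all entries have degree at most `n` and the
coefficient of `x^n` is the identity matrix. -/
def IsMonicDeg {N : ℕ} (P : MatPoly N) (n : ℕ) : Prop :=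
  (∀ i j, (P i j).degree ≤ (n : WithBot ℕ)) ∧ mcoeff P n = 1

/-- `T` is (the right action of) a matrix differential operator with polynomial
coefficients. -/
def IsMatDiffOp {N : ℕ} (T : MatPoly N → MatPoly N) : Prop :=
  ∃ (m : ℕ) (F : ℕ → MatPoly N), ∀ P, T P = opApply m F P

/-- The algebra `𝔇` of differential operators having each `P_n` as an eigenfunction
with a constant (matrix) eigenvalue. -/
def algD {N : ℕ} (P : ℕ → MatPoly N) : Set (MatPoly N → MatPoly N) :=
  {T | IsMatDiffOp T ∧ ∃ Λ : ℕ → Matrix (Fin N) (Fin N) ℂ, ∀ n, T (P n) = cm (Λ n) * P n}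

section MatPolyLemmas

variable {N : ℕ}

lemma matDeriv_add (P Q : MatPoly N) : matDeriv (P + Q) = matDeriv P + matDeriv Q := by
  ext1 i j
  simp [matDeriv]

lemma matDeriv_mul (P Q : MatPoly N) :
    matDeriv (P * Q) = matDeriv P * Q + P * matDeriv Q := by
  ext1 i j
  simp [matDeriv, Matrix.mul_apply, Finset.sum_add_distrib]

lemma matDeriv_cm (M : Matrix (Fin N) (Fin N) ℂ) : matDeriv (cm M) = 0 := by
  ext1 i j
  simp [matDeriv, cm]

lemma matDeriv_cm_mul (M : Matrix (Fin N) (Fin N) ℂ) (P : MatPoly N) :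
    matDeriv (cm M * P) = cm M * matDeriv P := by
  rw [matDeriv_mul, matDeriv_cm, zero_mul, zero_add]

lemma matDeriv_iterate_add (k : ℕ) (P Q : MatPoly N) :
    matDeriv^[k] (P + Q) = matDeriv^[k] P + matDeriv^[k] Q := by
  induction k with
  | zero => rfl
  | succ k ih => simp only [Function.iterate_succ_apply', ih, matDeriv_add]

lemma matDeriv_iterate_cm_mul (k : ℕ) (M : Matrix (Fin N) (Fin N) ℂ) (P : MatPoly N) :
    matDeriv^[k] (cm M * P) = cm M * matDeriv^[k] P := by
  induction k with
  | zero => rfl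
  | succ k ih => simp only [Function.iterate_succ_apply', ih, matDeriv_cm_mul]

lemma matDeriv_sum {ι : Type*} (s : Finset ι) (f : ι → MatPoly N) :
    matDeriv (∑ i ∈ s, f i) = ∑ i ∈ s, matDeriv (f i) :=
  map_sum (AddMonoidHom.mk' matDeriv matDeriv_add) f s

lemma cm_mul (A B : Matrix (Fin N) (Fin N) ℂ) : cm (A * B) = cm A * cm B :=
  Matrix.map_mul (f := (C : ℂ →+* ℂ[X]))

lemma cm_one : cm (1 : Matrix (Fin N) (Fin N) ℂ) = 1 :=
  Matrix.map_one C (map_zero C) (map_one C)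

lemma mcoeff_cm_mul (M : Matrix (Fin N) (Fin N) ℂ) (P : MatPoly N) (k : ℕ) :
    mcoeff (cm M * P) k = M * mcoeff P k := by
  ext i j
  simp [mcoeff, cm, Matrix.mul_apply]

lemma mcoeff_sub (P Q : MatPoly N) (k : ℕ) : mcoeff (P - Q) k = mcoeff P k - mcoeff Q k := by
  ext i j
  simp [mcoeff]

lemma eq_zero_of_mcoeff_eq_zero {P : MatPoly N} (h : ∀ k, mcoeff P k = 0) : P = 0 := by
  ext i j k
  simpa [mcoeff] using congrFun₂ (h k) i j

lemma exists_mcoeff_eq_zero_of_le (P : MatPoly N) : ∃ n, ∀ k, n ≤ k → mcoeff P k = 0 := by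
  refine ⟨(∑ i, ∑ j, (P i j).natDegree) + 1, fun k hk => ?_⟩
  ext i j
  refine coeff_eq_zero_of_natDegree_lt (lt_of_lt_of_le (Nat.lt_succ_of_le ?_) hk)
  exact (Finset.single_le_sum (f := fun j => (P i j).natDegree)
      (fun _ _ => Nat.zero_le _) (Finset.mem_univ j)).trans
    (Finset.single_le_sum (f := fun i => ∑ j, (P i j).natDegree)
      (fun _ _ => Nat.zero_le _) (Finset.mem_univ i))

lemma IsMonicDeg.mcoeff_eq_zero {P : MatPoly N} {n k : ℕ} (hP : IsMonicDeg P n) (hk : n < k) :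
    mcoeff P k = 0 := by
  ext i j
  exact coeff_eq_zero_of_degree_lt ((hP.1 i j).trans_lt (by exact_mod_cast hk))

lemma IsMonicDeg.cm_mul_right_cancel {P : MatPoly N} {n : ℕ} (hP : IsMonicDeg P n)
    {A B : Matrix (Fin N) (Fin N) ℂ} (h : cm A * P = cm B * P) : A = B := by
  simpa [mcoeff_cm_mul, hP.2] using congrArg (mcoeff · n) h

namespace IsMatDiffOp

variable {S T : MatPoly N → MatPoly N}

lemma map_add (hT : IsMatDiffOp T) (P Q : MatPoly N) : T (P + Q) = T P + T Q := by
  obtain ⟨m, F, h⟩ := hT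
  simp only [h, opApply, matDeriv_iterate_add, add_mul, Finset.sum_add_distrib]

lemma map_cm_mul (hT : IsMatDiffOp T) (M : Matrix (Fin N) (Fin N) ℂ) (P : MatPoly N) :
    T (cm M * P) = cm M * T P := by
  obtain ⟨m, F, h⟩ := hT
  simp only [h, opApply, matDeriv_iterate_cm_mul, mul_assoc, Finset.mul_sum]

lemma iterate_matDeriv_mul (k : ℕ) (F : MatPoly N) :
    IsMatDiffOp fun P : MatPoly N => matDeriv^[k] P * F := by
  refine ⟨k, fun j => if j = k then F else 0, fun P => ?_⟩
  simp [opApply]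

lemma id : IsMatDiffOp fun P : MatPoly N => P := by
  simpa using iterate_matDeriv_mul 0 (1 : MatPoly N)

lemma zero : IsMatDiffOp fun _ : MatPoly N => 0 :=
  ⟨0, 0, fun P => by simp [opApply]⟩

lemma add (hS : IsMatDiffOp S) (hT : IsMatDiffOp T) : IsMatDiffOp fun P => S P + T P := by
  obtain ⟨m, F, hF⟩ := hS
  obtain ⟨n, G, hG⟩ := hT
  have extend : ∀ (a b : ℕ) (H : ℕ → MatPoly N) (P : MatPoly N), a ≤ b →
      opApply a H P = opApply b (fun j => if j ∈ Finset.range (a + 1) then H j else 0) P := by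
    intro a b H P hab
    simp only [opApply, mul_ite, mul_zero]
    rw [Finset.sum_ite_mem, Finset.inter_eq_right.2 (Finset.range_mono (by omega))]
  refine ⟨max m n, fun j => (if j ∈ Finset.range (m + 1) then F j else 0) +
    (if j ∈ Finset.range (n + 1) then G j else 0), fun P => ?_⟩
  simp only [hF, hG]
  rw [extend m _ F P (le_max_left m n), extend n _ G P (le_max_right m n)]
  simp only [opApply, mul_add, Finset.sum_add_distrib]

lemma sum {ι : Type*} (s : Finset ι) {f : ι → MatPoly N → MatPoly N}
    (hf : ∀ i ∈ s, IsMatDiffOp (f i)) : IsMatDiffOp fun P => ∑ i ∈ s, f i P := by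
  classical
  induction s using Finset.induction_on with
  | empty => simpa using zero
  | insert i s hi ih =>
    simp only [Finset.sum_insert hi]
    exact (hf i (Finset.mem_insert_self i s)).add
      (ih fun j hj => hf j (Finset.mem_insert_of_mem hj))

lemma mul_right (hT : IsMatDiffOp T) (G : MatPoly N) : IsMatDiffOp fun P => T P * G := by
  obtain ⟨m, F, h⟩ := hT
  refine ⟨m, fun j => F j * G, fun P => ?_⟩
  simp only [h, opApply, Finset.sum_mul, mul_assoc]

lemma matDeriv_comp (hT : IsMatDiffOp T) : IsMatDiffOp fun P => matDeriv (T P) := by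
  obtain ⟨m, F, h⟩ := hT
  simp only [h, opApply, matDeriv_sum, matDeriv_mul, ← Function.iterate_succ_apply']
  exact sum _ fun j _ => (iterate_matDeriv_mul _ _).add (iterate_matDeriv_mul _ _)

lemma comp (hS : IsMatDiffOp S) (hT : IsMatDiffOp T) : IsMatDiffOp fun P => S (T P) := by
  obtain ⟨m, F, h⟩ := hS
  simp only [h, opApply]
  suffices H : ∀ j, IsMatDiffOp fun P => matDeriv^[j] (T P) from
    sum _ fun j _ => (H j).mul_right _
  intro j
  induction j with
  | zero => exact hT
  | succ j ih =>
    simp only [Function.iterate_succ_apply']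
    exact ih.matDeriv_comp

/-- A differential operator is determined by its values on a monic sequence. -/
lemma ext_of_monic (hS : IsMatDiffOp S) (hT : IsMatDiffOp T) {P : ℕ → MatPoly N}
    (hP : ∀ n, IsMonicDeg (P n) n) (h : ∀ n, S (P n) = T (P n)) (Q : MatPoly N) :
    S Q = T Q := by
  obtain ⟨n, hn⟩ := exists_mcoeff_eq_zero_of_le Q
  induction n generalizing Q with
  | zero =>
    have hQ : Q = cm 0 * P 0 := by
      simp [eq_zero_of_mcoeff_eq_zero fun k => hn k k.zero_le, cm]
    rw [hQ, hS.map_cm_mul, hT.map_cm_mul, h]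
  | succ n ih =>
    have hR := ih (Q - cm (mcoeff Q n) * P n) fun k hk => by
      rw [mcoeff_sub, mcoeff_cm_mul]
      rcases hk.eq_or_lt with rfl | hk
      · rw [(hP n).2, mul_one, sub_self]
      · rw [(hP n).mcoeff_eq_zero hk, hn k hk, mul_zero, sub_zero]
    rw [← sub_add_cancel Q (cm (mcoeff Q n) * P n), hS.map_add, hT.map_add, hR,
      hS.map_cm_mul, hT.map_cm_mul, h]

end IsMatDiffOp

lemma commutative_algD_of_darboux {P Pt : ℕ → MatPoly N}
    (hP : ∀ n, IsMonicDeg (P n) n) (hPt : ∀ n, IsMonicDeg (Pt n) n)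
    {V W : MatPoly N → MatPoly N} (hV : IsMatDiffOp V) (hW : IsMatDiffOp W)
    {A At : ℕ → Matrix (Fin N) (Fin N) ℂ}
    (hA : ∀ n, IsUnit (A n)) (hAt : ∀ n, IsUnit (At n))
    (hVP : ∀ n, V (P n) = cm (A n) * Pt n) (hWPt : ∀ n, W (Pt n) = cm (At n) * P n)
    (hcomm : ∀ B₁ ∈ algD P, ∀ B₂ ∈ algD P, ∀ Q, B₂ (B₁ Q) = B₁ (B₂ Q)) :
    ∀ B₁ ∈ algD Pt, ∀ B₂ ∈ algD Pt, ∀ Q, B₂ (B₁ Q) = B₁ (B₂ Q) := by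
  have conj_apply : ∀ {B : MatPoly N → MatPoly N} {L : ℕ → Matrix (Fin N) (Fin N) ℂ},
      IsMatDiffOp B → (∀ n, B (Pt n) = cm (L n) * Pt n) →
      ∀ n, W (B (V (P n))) = cm (A n * L n * At n) * P n := by
    intro B L hB hL n
    rw [hVP, hB.map_cm_mul, hL, hW.map_cm_mul, hW.map_cm_mul, hWPt]
    simp only [cm_mul, mul_assoc]
  have twisted_comm : ∀ {B₁ B₂ : MatPoly N → MatPoly N} {L₁ L₂ : ℕ → Matrix (Fin N) (Fin N) ℂ},
      IsMatDiffOp B₁ → IsMatDiffOp B₂ → (∀ n, B₁ (Pt n) = cm (L₁ n) * Pt n) →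
      (∀ n, B₂ (Pt n) = cm (L₂ n) * Pt n) →
      ∀ n, L₁ n * (At n * A n) * L₂ n = L₂ n * (At n * A n) * L₁ n := by
    intro B₁ B₂ L₁ L₂ hB₁ hB₂ hL₁ hL₂ n
    have hD₁ : IsMatDiffOp fun Q => W (B₁ (V Q)) := hW.comp (hB₁.comp hV)
    have hD₂ : IsMatDiffOp fun Q => W (B₂ (V Q)) := hW.comp (hB₂.comp hV)
    have h := hcomm _ ⟨hD₁, _, conj_apply hB₁ hL₁⟩ _ ⟨hD₂, _, conj_apply hB₂ hL₂⟩ (P n)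
    have e₁ := hD₁.map_cm_mul (A n * L₂ n * At n) (P n)
    have e₂ := hD₂.map_cm_mul (A n * L₁ n * At n) (P n)
    rw [conj_apply hB₁ hL₁, conj_apply hB₂ hL₂, e₁, e₂, conj_apply hB₁ hL₁, conj_apply hB₂ hL₂,
      ← mul_assoc, ← mul_assoc, ← cm_mul, ← cm_mul] at h
    have heig := (hP n).cm_mul_right_cancel h
    apply (hA n).mul_left_cancel
    apply (hAt n).mul_right_cancel
    simpa only [mul_assoc] using heig
  rintro B₁ ⟨hB₁, L₁, hL₁⟩ B₂ ⟨hB₂, L₂, hL₂⟩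
  refine (hB₂.comp hB₁).ext_of_monic (hB₁.comp hB₂) hPt fun n => ?_
  have hid : ∀ n, (fun Q : MatPoly N => Q) (Pt n) = cm ((fun _ => 1) n) * Pt n := fun n => by
    simp [cm_one]
  have h₁ : L₁ n * (At n * A n) = At n * A n * L₁ n := by
    simpa using twisted_comm hB₁ .id hL₁ hid n
  have h₂ : L₂ n * (At n * A n) = At n * A n * L₂ n := by
    simpa using twisted_comm hB₂ .id hL₂ hid n
  have h₃ := twisted_comm hB₁ hB₂ hL₁ hL₂ n
  rw [h₁, h₂, mul_assoc, mul_assoc (At n * A n)] at h₃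
  have hL : L₁ n * L₂ n = L₂ n * L₁ n := ((hAt n).mul (hA n)).mul_left_cancel h₃
  rw [hL₁, hL₂, hB₁.map_cm_mul, hB₂.map_cm_mul, hL₁, hL₂, ← mul_assoc, ← mul_assoc, ← cm_mul,
    ← cm_mul, hL]

end MatPolyLemmas

/-- **Commutativity under Darboux transformations.** If `P_n·𝒱 = A_n·P̃_n` and
`P̃_n·𝒩 = Ã_n·P_n` with `A_n, Ã_n` invertible, then `𝔇` is commutative under
composition if and only if `𝔇̃` is. -/
theorem commutative_iff_darboux {N : ℕ} (P Pt : ℕ → MatPoly N)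
    (hP : ∀ n, IsMonicDeg (P n) n) (hPt : ∀ n, IsMonicDeg (Pt n) n)
    (V Nop : MatPoly N → MatPoly N) (hV : IsMatDiffOp V) (hN : IsMatDiffOp Nop)
    (An Atn : ℕ → Matrix (Fin N) (Fin N) ℂ)
    (hAn : ∀ n, IsUnit (An n)) (hAtn : ∀ n, IsUnit (Atn n))
    (h1 : ∀ n, V (P n) = cm (An n) * Pt n)
    (h2 : ∀ n, Nop (Pt n) = cm (Atn n) * P n) :
    (∀ B₁ ∈ algD P, ∀ B₂ ∈ algD P, ∀ Q, B₂ (B₁ Q) = B₁ (B₂ Q)) ↔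
    (∀ B₁ ∈ algD Pt, ∀ B₂ ∈ algD Pt, ∀ Q, B₂ (B₁ Q) = B₁ (B₂ Q)) := by
  exact ⟨commutative_algD_of_darboux hP hPt hV hN hAn hAtn h1 h2,
    commutative_algD_of_darboux hPt hP hN hV hAtn hAn h2 h1⟩
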